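/- If N is an invariant subspace of ℂ[x,x⁻¹] of finite codimension as a ℂ-vector space, then N = ℂ[x,x⁻¹]. Equivalently, the module j₀M has no nonzero finite-dimensional quotient module. -/

import Mathlib

noncomputable section

/-- The Laurent polynomial ring `ℂ[x,x⁻¹]`, viewed as the space of finitely supported
coefficient functions `ℤ →₀ ℂ`; the monomial `x^n` is `Finsupp.single n 1`. -/
abbrev LaurentC : Type := ℤ →₀ ℂ

/-- The `ℂ`-linear endomorphism of `ℂ[x,x⁻¹]` determined by its values on the monomials
`x^n`, `n : ℤ`. -/
noncomputable def onMonomials (g : ℤ → LaurentC) : LaurentC →ₗ[ℂ] LaurentC :=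
  Finsupp.lsum ℂ fun n => LinearMap.toSpanSingleton ℂ LaurentC (g n)

/-- Multiplication by `x`. -/
noncomputable def mulX : LaurentC →ₗ[ℂ] LaurentC :=
  onMonomials fun n => Finsupp.single (n + 1) 1

/-- The operator `s_i : x^n ↦ λ^{i n} x^n`. -/
noncomputable def sOp (lam : ℂ) (i : ℕ) : LaurentC →ₗ[ℂ] LaurentC :=
  onMonomials fun n => Finsupp.single n (lam ^ ((i : ℤ) * n))

/-- The Dunkl operator
`D(x^n) = n x^{n-1} + p·x^n + Σ_{i=1}^{m-1} (2 c_i (1-λ^{in})/(1-λ^i)) x^{n-1}`. -/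
noncomputable def dunkl (m : ℕ) (lam : ℂ) (c : ℕ → ℂ) (p : LaurentC) : LaurentC →ₗ[ℂ] LaurentC :=
  onMonomials fun n =>
    Finsupp.mapDomain (· + n) p +
      ((n : ℂ) + ∑ i ∈ Finset.Icc 1 (m - 1),
          2 * c i * (1 - lam ^ ((i : ℤ) * n)) / (1 - lam ^ (i : ℤ))) • Finsupp.single (n - 1) 1

/-- A subspace `N ⊆ ℂ[x,x⁻¹]` is an invariant subspace if it is closed under multiplication
by `x`, under `s_1`, and under the Dunkl operator `D`; invariant subspaces are exactly the
submodules of the rational Cherednik algebra module `j₀M`. -/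
def IsInvariantSubspace (m : ℕ) (lam : ℂ) (c : ℕ → ℂ) (p : LaurentC) (N : Submodule ℂ LaurentC) : Prop :=
  (∀ f ∈ N, mulX f ∈ N) ∧ (∀ f ∈ N, sOp lam 1 f ∈ N) ∧ (∀ f ∈ N, dunkl m lam c p f ∈ N)

/-- The subspace `x^k ℂ[x]`: the span of the monomials `x^n` with `n ≥ k`. -/
noncomputable def tailSpace (k : ℤ) : Submodule ℂ LaurentC :=
  Submodule.span ℂ {f : LaurentC | ∃ n : ℤ, k ≤ n ∧ f = Finsupp.single n 1}

lemma onMonomials_single (g : ℤ → LaurentC) (n : ℤ) (a : ℂ) :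
    onMonomials g (Finsupp.single n a) = a • g n := by
  simp [onMonomials]

lemma mulX_pow_single (k : ℕ) (n : ℤ) (a : ℂ) :
    (mulX ^ k) (Finsupp.single n a) = Finsupp.single (n + k) a := by
  induction k generalizing n with
  | zero => simp
  | succ k ih =>
    rw [pow_succ, Module.End.mul_apply]
    have : mulX (Finsupp.single n a) = Finsupp.single (n + 1) a := by
      simp [mulX, onMonomials_single]
    rw [this, ih]
    congr 1
    push_cast
    ring

lemma mulX_pow_eq (k : ℕ) (f : LaurentC) :
    (mulX ^ k) f = Finsupp.mapDomain (· + (k : ℤ)) f := by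
  have : (mulX ^ k) = Finsupp.lmapDomain ℂ ℂ (· + (k : ℤ)) := by
    ext n : 2
    simp [mulX_pow_single]
  rw [this]
  rfl

lemma mulX_surj : Function.Surjective mulX := by
  intro f
  refine ⟨Finsupp.mapDomain (· - 1) f, ?_⟩
  have h := mulX_pow_eq 1 (Finsupp.mapDomain (· - 1) f)
  rw [pow_one] at h
  rw [h, ← Finsupp.mapDomain_comp]
  convert Finsupp.mapDomain_id
  ext n
  simp

lemma dunkl_comm (m : ℕ) (hm : 2 ≤ m) (lam : ℂ) (hlam : IsPrimitiveRoot lam m)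
    (c : ℕ → ℂ) (p : LaurentC) (f : LaurentC) :
    dunkl m lam c p ((mulX ^ m) f) =
      (mulX ^ m) (dunkl m lam c p f) + (m : ℂ) • (mulX ^ (m - 1)) f := by
  have hl0 : lam ≠ 0 := hlam.ne_zero (by omega)
  have hl : ∀ (i : ℕ) (n : ℤ), lam ^ ((i : ℤ) * (n + m)) = lam ^ ((i : ℤ) * n) := by
    intro i n
    rw [mul_add, zpow_add₀ hl0, mul_comm (i : ℤ) (m : ℤ), zpow_mul lam (m : ℤ), zpow_natCast lam m,
      hlam.pow_eq_one, one_zpow, mul_one]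
  induction f using Finsupp.induction_linear with
  | zero => simp
  | add f g hf hg => simp only [map_add, hf, hg, smul_add]; abel
  | single n a =>
    rw [mulX_pow_single, mulX_pow_single, dunkl, onMonomials_single, onMonomials_single]
    simp only [hl]
    generalize (∑ i ∈ Finset.Icc 1 (m - 1),
          2 * c i * (1 - lam ^ ((i : ℤ) * n)) / (1 - lam ^ (i : ℤ))) = S
    rw [map_smul, map_add, map_smul, mulX_pow_single, mulX_pow_eq, ← Finsupp.mapDomain_comp]
    have e1 : ((fun x : ℤ => x + (m : ℤ)) ∘ fun x => x + n) = fun x => x + (n + m) := by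
      ext x; simp; ring
    have e2 : n + ((m - 1 : ℕ) : ℤ) = n + m - 1 := by omega
    have e3 : n - 1 + (m : ℤ) = n + m - 1 := by ring
    have e4 : Finsupp.single (n + (m : ℤ) - 1) a = a • Finsupp.single (n + (m : ℤ) - 1) (1 : ℂ) := by
      simp
    rw [e1, e2, e3, e4]
    push_cast
    module

/-- An invariant subspace of finite codimension is all of `ℂ[x,x⁻¹]`; equivalently, `j₀M`
has no nonzero finite-dimensional quotient module. -/
theorem eq_top_of_finite_codimension
    (m : ℕ) (hm : 2 ≤ m) (lam : ℂ) (hlam : IsPrimitiveRoot lam m)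
    (c : ℕ → ℂ) (p : LaurentC) (hp : ∀ n : ℤ, ¬ ((m : ℤ) ∣ (n + 1)) → p n = 0)
    (N : Submodule ℂ LaurentC) (hN : IsInvariantSubspace m lam c p N)
    (hfin : FiniteDimensional ℂ (LaurentC ⧸ N)) : N = ⊤ := by
  obtain ⟨hX, -, hD⟩ := hN
  let X : Module.End ℂ (LaurentC ⧸ N) := N.mapQ N mulX hX
  let D : Module.End ℂ (LaurentC ⧸ N) := N.mapQ N (dunkl m lam c p) hD
  have hXs : Function.Surjective X := by
    intro q
    obtain ⟨f, rfl⟩ := N.mkQ_surjective q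
    obtain ⟨g, rfl⟩ := mulX_surj f
    exact ⟨N.mkQ g, rfl⟩
  have hXu : IsUnit X := (LinearMap.isUnit_iff_range_eq_top X).2 (LinearMap.range_eq_top.2 hXs)
  have hXp : ∀ (k : ℕ) (f : LaurentC), (X ^ k) (N.mkQ f) = N.mkQ ((mulX ^ k) f) := by
    intro k
    induction k with
    | zero => intro f; rfl
    | succ k ih =>
      intro f
      rw [pow_succ, pow_succ, Module.End.mul_apply, Module.End.mul_apply, ← ih]
      rfl
  have hDm : ∀ f : LaurentC, D (N.mkQ f) = N.mkQ (dunkl m lam c p f) := fun _ => rfl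
  have key : D * X ^ m = X ^ m * D + (m : ℂ) • X ^ (m - 1) := by
    refine LinearMap.ext fun q => ?_
    obtain ⟨f, rfl⟩ := N.mkQ_surjective q
    simp only [Module.End.mul_apply, LinearMap.add_apply, LinearMap.smul_apply, hXp, hDm]
    rw [dunkl_comm m hm lam hlam, map_add, map_smul]
  obtain ⟨Y, hXY, hYX⟩ := isUnit_iff_exists.1 (hXu.pow (m - 1))
  have hm1 : X ^ m = X * X ^ (m - 1) := by rw [← pow_succ']; congr 1; omega
  have hm2 : X ^ m = X ^ (m - 1) * X := by rw [← pow_succ]; congr 1; omega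
  have t := congrArg (fun Z => LinearMap.trace ℂ _ (Z * Y)) key
  have a1 : D * X ^ m * Y = D * X := by rw [hm1, mul_assoc, mul_assoc, hXY, mul_one]
  have a2 : LinearMap.trace ℂ _ (X ^ m * D * Y) = LinearMap.trace ℂ _ (D * X) := by
    rw [LinearMap.trace_mul_comm, ← mul_assoc, hm2, ← mul_assoc, hYX, one_mul,
      LinearMap.trace_mul_comm]
  simp only [add_mul, map_add, a1, a2, smul_mul_assoc, hXY, map_smul, LinearMap.trace_one] at t
  have h0 : (Module.finrank ℂ (LaurentC ⧸ N) : ℂ) = 0 := by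
    have hmz : (m : ℂ) ≠ 0 := by
      have : m ≠ 0 := by omega
      exact_mod_cast this
    have := left_eq_add.1 t
    simpa [hmz] using this
  have h0' : Module.finrank ℂ (LaurentC ⧸ N) = 0 := by exact_mod_cast h0
  have := Module.finrank_zero_iff.1 h0'
  exact Submodule.Quotient.subsingleton_iff.1 this
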